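/- Let G be a Ferrers graph on vertex sets {x_1,…,x_n} and {y_1,…,y_n}, with edge ideal I = I(G) in S = K[x_1,…,x_n,y_1,…,y_n]. Then S/I is Cohen-Macaulay if and only if the Hilbert series of S/I equals (1 + n t)/(1 − t)^n. -/

import Mathlib

open Finset

/-- The `d`-th value of the Hilbert function of `R⧸I`, `R = K[x_v : v ∈ σ]`:
the `K`-dimension of the image of the degree-`d` homogeneous component. -/
noncomputable def hilbertFn (K : Type*) [Field K] {σ : Type*}
    (I : Ideal (MvPolynomial σ K)) (d : ℕ) : ℕ :=
  Module.finrank K ((MvPolynomial.homogeneousSubmodule σ K d).map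
    (Ideal.Quotient.mkₐ K I).toLinearMap)

/-- The depth of a commutative ring `A` with respect to an ideal `m`:
the supremum of lengths of regular sequences contained in `m`. -/
noncomputable def idealDepth {A : Type*} [CommRing A] (m : Ideal A) : ℕ∞ :=
  sSup {n : ℕ∞ | ∃ rs : List A, (rs.length : ℕ∞) = n ∧ (∀ r ∈ rs, r ∈ m) ∧
    RingTheory.Sequence.IsRegular A rs}

/-- The Stanley–Reisner ideal of a simplicial complex given by its set of
faces: generated by the squarefree monomials corresponding to nonfaces. -/
noncomputable def srIdeal (K : Type*) [Field K] {V : Type*} [DecidableEq V] [Fintype V]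
    (faces : Finset (Finset V)) : Ideal (MvPolynomial V K) :=
  Ideal.span {p | ∃ F : Finset V, F ∉ faces ∧ p = ∏ v ∈ F, MvPolynomial.X v}

/-- The irrelevant maximal ideal of `K[x] ⧸ I`: generated by the images of the
variables. -/
noncomputable def irrelevantIdeal (K : Type*) [Field K] {σ : Type*}
    (I : Ideal (MvPolynomial σ K)) : Ideal (MvPolynomial σ K ⧸ I) :=
  Ideal.span (Set.range fun v => Ideal.Quotient.mk I (MvPolynomial.X v))

/-- `K[x] ⧸ I` is Cohen–Macaulay: its depth with respect to the irrelevant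
maximal ideal equals its Krull dimension. -/
noncomputable def QuotIsCM (K : Type*) [Field K] {σ : Type*}
    (I : Ideal (MvPolynomial σ K)) : Prop :=
  ringKrullDim (MvPolynomial σ K ⧸ I) = (idealDepth (irrelevantIdeal K I) : WithBot ℕ∞)

/-- `K[x] ⧸ I` is almost Cohen–Macaulay: `depth ≥ dim − 1`. -/
noncomputable def QuotIsAlmostCM (K : Type*) [Field K] {σ : Type*}
    (I : Ideal (MvPolynomial σ K)) : Prop :=
  ringKrullDim (MvPolynomial σ K ⧸ I) ≤ ((idealDepth (irrelevantIdeal K I) + 1 : ℕ∞) : WithBot ℕ∞)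

/-- The Hilbert series of `K[x]⧸I` as a formal power series over `ℤ`. -/
noncomputable def hilbertSeries (K : Type*) [Field K] {σ : Type*}
    (I : Ideal (MvPolynomial σ K)) : PowerSeries ℤ :=
  PowerSeries.mk fun d => (hilbertFn K I d : ℤ)


section CommAlg

open RingTheory.Sequence IsLocalRing CategoryTheory Abelian
open scoped Pointwise

/-- Lifting an associated prime along a regular element. -/
lemma ferr_ass_step {R M : Type*} [CommRing R] [IsNoetherianRing R] [IsLocalRing R]
    [AddCommGroup M] [Module R M] [Module.Finite R M] {r : R} (hr : r ∈ maximalIdeal R)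
    (hreg : IsSMulRegular M r) {P : Ideal R} (hP : P ∈ associatedPrimes R M) :
    ∃ Q ∈ associatedPrimes R (QuotSMulTop r M), P < Q := by
  obtain ⟨hPp, u, hu⟩ := isAssociatedPrime_iff.mp hP
  have hu' : ∀ p : R, p ∈ P ↔ p • u = 0 := by
    intro p
    rw [hu, Submodule.mem_colon_singleton, Submodule.mem_bot]
  have hu0 : u ≠ 0 := by
    rintro rfl
    apply hPp.ne_top
    rw [Ideal.eq_top_iff_one, hu']
    simp
  have hrP : r ∉ P := by
    intro h
    rw [hu'] at h
    exact hu0 (hreg (by simpa using h))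
  let N : Submodule R M := Submodule.torsionBySet R M (P : Set R)
  have hN : ∀ v : M, v ∈ N ↔ ∀ p ∈ P, p • v = 0 := by
    intro v
    simp [N, Submodule.mem_torsionBySet_iff]
  have huN : u ∈ N := by
    rw [hN]; intro p hp; exact (hu' p).mp hp
  obtain ⟨v, hvN, hv⟩ : ∃ v ∈ N, v ∉ (r • (⊤ : Submodule R M)) := by
    by_contra hcon
    push Not at hcon
    have hle : N ≤ (Ideal.span {r}) • N := by
      intro v hv
      have h1 := hcon v hv
      rw [Submodule.mem_smul_pointwise_iff_exists] at h1
      obtain ⟨w, -, rfl⟩ := h1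
      rw [Submodule.ideal_span_singleton_smul]
      apply Submodule.smul_mem_pointwise_smul
      rw [hN] at hv ⊢
      intro p hp
      have := hv p hp
      rw [smul_comm] at this
      exact hreg (by simpa using this)
    have hbot := Submodule.eq_bot_of_le_smul_of_le_jacobson_bot (Ideal.span {r}) N
      (IsNoetherian.noetherian N) hle (by
        rw [Ideal.span_singleton_le_iff_mem, IsLocalRing.jacobson_eq_maximalIdeal _ bot_ne_top]
        exact hr)
    rw [hbot] at huN
    exact hu0 (by simpa using huN)
  have hv0 : (Submodule.Quotient.mk v : QuotSMulTop r M) ≠ 0 := by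
    rwa [Ne, Submodule.Quotient.mk_eq_zero]
  obtain ⟨Q, hQ, hle⟩ := exists_le_isAssociatedPrime_of_isNoetherianRing R _ hv0
  refine ⟨Q, hQ, lt_of_le_of_ne ?_ ?_⟩
  · intro p hp
    apply hle
    rw [Submodule.mem_colon_singleton, Submodule.mem_bot, ← Submodule.Quotient.mk_smul,
      (hN v).mp hvN p hp, Submodule.Quotient.mk_zero]
  · rintro rfl
    apply hrP
    apply hle
    rw [Submodule.mem_colon_singleton, Submodule.mem_bot, ← Submodule.Quotient.mk_smul,
      Submodule.Quotient.mk_eq_zero]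
    exact Submodule.smul_mem_pointwise_smul _ _ _ trivial

lemma ferr_chain {R : Type*} [CommRing R] [IsNoetherianRing R] [IsLocalRing R] (rs : List R) :
    ∀ {M : Type*} [AddCommGroup M] [Module R M] [Module.Finite R M]
    (_ : ∀ r ∈ rs, r ∈ maximalIdeal R) (_ : IsWeaklyRegular M rs)
    {P : Ideal R} (_ : P ∈ associatedPrimes R M),
    ∃ p : LTSeries (PrimeSpectrum R), p.length = rs.length ∧ p.head.asIdeal = P := by
  induction rs with
  | nil =>
    intro M _ _ _ _ _ P hP
    exact ⟨RelSeries.singleton _ ⟨P, hP.1⟩, rfl, rfl⟩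
  | cons r rs ih =>
    intro M _ _ _ hm hreg P hP
    rw [isWeaklyRegular_cons_iff] at hreg
    obtain ⟨Q, hQ, hPQ⟩ := ferr_ass_step (hm r (by simp)) hreg.1 hP
    obtain ⟨p, hp, hh⟩ := ih (fun a ha => hm a (by simp [ha])) hreg.2 hQ
    have hlt : (⟨P, hP.1⟩ : PrimeSpectrum R) < p.head := by
      rw [← PrimeSpectrum.asIdeal_lt_asIdeal, hh]
      exact hPQ
    exact ⟨p.cons ⟨P, hP.1⟩ hlt, by simp [hp], by simp⟩

/-- Exchange lemma, by the theorem of Rees. -/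
lemma ferr_exchange {R : Type*} [CommRing R] [IsNoetherianRing R] [IsLocalRing R]
    (s : R) (hs : s ∈ maximalIdeal R) (hreg : IsSMulRegular R s) (d : ℕ)
    (rs : List R) (hlen : rs.length = d + 1) (hm : ∀ r ∈ rs, r ∈ maximalIdeal R)
    (hrs : IsRegular R rs) :
    ∃ ts : List R, ts.length = d ∧ (∀ r ∈ ts, r ∈ maximalIdeal R) ∧
      IsRegular (QuotSMulTop s R) ts := by
  have h0 : maximalIdeal R • (⊤ : Submodule R R) < ⊤ := by
    rw [lt_top_iff_ne_top]
    simpa using (maximalIdeal.isMaximal R).ne_top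
  have h1 : maximalIdeal R • (⊤ : Submodule R (QuotSMulTop s R)) < ⊤ := by
    rw [lt_top_iff_ne_top]
    have : Nontrivial (QuotSMulTop s R) := nontrivial_quotSMulTop_of_mem_maximalIdeal R hs
    exact (Submodule.top_ne_ideal_smul_of_le_jacobson_annihilator
      (maximalIdeal_le_jacobson _)).symm
  have hsupp : Module.support R (R ⧸ maximalIdeal R) =
      PrimeSpectrum.zeroLocus (maximalIdeal R : Set R) := by
    rw [Module.support_eq_zeroLocus, Ideal.annihilator_quotient]
  have hE := ModuleCat.subsingleton_ext_of_exists_isRegular (maximalIdeal R)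
    (ModuleCat.of R (R ⧸ maximalIdeal R)) hsupp.subset (ModuleCat.of R R) h0 rs hm hrs
  have hreg' : IsSMulRegular (ModuleCat.of R R) s := hreg
  refine ModuleCat.exists_isRegular_of_exists_subsingleton_ext (maximalIdeal R) d
    (ModuleCat.of R (QuotSMulTop s R)) h1 (ModuleCat.of R (R ⧸ maximalIdeal R)) hsupp ?_
  intro i hi
  have zero1 := AddCommGrpCat.isZero_of_iff_subsingleton.mpr (hE i (by omega))
  have zero2 := AddCommGrpCat.isZero_of_iff_subsingleton.mpr (hE (i + 1) (by omega))
  exact AddCommGrpCat.subsingleton_of_isZero <| ShortComplex.Exact.isZero_of_both_zeros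
    ((Ext.covariant_sequence_exact₃' _ hreg'.smulShortComplex_shortExact) i (i + 1) rfl)
    (zero1.eq_zero_of_src _) (zero2.eq_zero_of_tgt _)

/-- The depth bound. -/
lemma ferr_depth_bound {A : Type*} [CommRing A] [IsNoetherianRing A] (m : Ideal A) [m.IsPrime]
    (J : Ideal A) (θ u : A) (hθ : θ ∈ m) (hreg : IsSMulRegular A θ)
    (hJ : ∀ j ∈ J, j * u ∈ Ideal.span {θ}) (hu : ∀ s, s ∉ m → s * u ∉ Ideal.span {θ})
    (c : ℕ) (hc : ringKrullDim (A ⧸ J) ≤ c)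
    (rs : List A) (hm : ∀ r ∈ rs, r ∈ m) (hrs : IsRegular A rs) : rs.length ≤ c + 1 := by
  by_contra hcon
  push Not at hcon
  obtain ⟨d, hd⟩ : ∃ d, rs.length = d + 1 := ⟨rs.length - 1, by omega⟩
  let R := Localization.AtPrime m
  have hθR : IsSMulRegular R (algebraMap A R θ) := by
    have := IsWeaklyRegular.of_isLocalization R m.primeCompl
      ((isWeaklyRegular_singleton_iff A θ).mpr hreg)
    exact (isWeaklyRegular_singleton_iff _ _).mp (by simpa using this)
  have hmem : ∀ a ∈ m, algebraMap A R a ∈ maximalIdeal R := by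
    intro a ha
    exact (IsLocalization.AtPrime.to_map_mem_maximal_iff R m a).mpr ha
  have hrsR : IsRegular R (rs.map (algebraMap A R)) :=
    hrs.toIsWeaklyRegular.isRegular_of_isLocalization_of_mem R m hm
  obtain ⟨ts, htl, htm, htr⟩ := ferr_exchange (algebraMap A R θ) (hmem _ hθ) hθR d
    (rs.map (algebraMap A R)) (by simpa using hd) (by
      intro r hr
      obtain ⟨a, ha, rfl⟩ := List.mem_map.mp hr
      exact hmem _ (hm a ha)) hrsR
  let v : QuotSMulTop (algebraMap A R θ) R := Submodule.Quotient.mk (algebraMap A R u)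
  have hv : v ≠ 0 := by
    intro h
    rw [Submodule.Quotient.mk_eq_zero, Submodule.mem_smul_pointwise_iff_exists] at h
    obtain ⟨w, -, hw⟩ := h
    obtain ⟨⟨b, s⟩, hbs⟩ := IsLocalization.surj m.primeCompl w
    simp only at hbs
    have h2 : algebraMap A R (θ * b) = algebraMap A R (u * s) := by
      rw [map_mul, map_mul, ← hbs, ← hw, smul_eq_mul]; ring
    obtain ⟨t, ht⟩ := (IsLocalization.eq_iff_exists m.primeCompl R).mp h2
    have hts : (t : A) * s ∉ m := (t * s : m.primeCompl).2
    apply hu _ hts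
    rw [Ideal.mem_span_singleton]
    exact ⟨t * b, by linear_combination -ht⟩
  obtain ⟨P, hP, hle⟩ := exists_le_isAssociatedPrime_of_isNoetherianRing R v hv
  obtain ⟨p, hpl, hph⟩ := ferr_chain ts htm htr.toIsWeaklyRegular hP
  have hJP : ∀ j ∈ J, algebraMap A R j ∈ P := by
    intro j hj
    apply hle
    rw [Submodule.mem_colon_singleton, Submodule.mem_bot, ← Submodule.Quotient.mk_smul,
      Submodule.Quotient.mk_eq_zero, Submodule.mem_smul_pointwise_iff_exists]
    obtain ⟨w, hw⟩ := Ideal.mem_span_singleton.mp (hJ j hj)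
    exact ⟨algebraMap A R w, trivial, by rw [smul_eq_mul, smul_eq_mul, ← map_mul, ← map_mul, hw]⟩
  let φ : PrimeSpectrum R → PrimeSpectrum A := PrimeSpectrum.comap (algebraMap A R)
  have hφ : StrictMono φ := by
    apply Monotone.strictMono_of_injective
    · intro x y hxy
      exact Ideal.comap_mono hxy
    · exact PrimeSpectrum.localization_comap_injective R m.primeCompl
  have hz : ∀ i, φ (p i) ∈ PrimeSpectrum.zeroLocus (J : Set A) := by
    intro i j hj
    have h3 : p.head ≤ p i := p.monotone (Fin.zero_le _)
    apply h3
    rw [hph]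
    exact hJP j hj
  let q : LTSeries (PrimeSpectrum.zeroLocus (J : Set A)) :=
    { length := p.length
      toFun := fun i => ⟨φ (p i), hz i⟩
      step := fun i => hφ (p.step i) }
  have h4 : (q.length : WithBot ℕ∞) ≤ c := by
    refine le_trans ?_ hc
    rw [ringKrullDim_quotient]
    exact Order.LTSeries.length_le_krullDim q
  have h5 : q.length ≤ c := by exact_mod_cast h4
  have : q.length = p.length := rfl
  omega

end CommAlg
section Monomial

open MvPolynomial

/-- The homomorphism killing the variables in `s`. -/
noncomputable def ferrKill (K : Type*) [Field K] {τ : Type*} [DecidableEq τ] (s : Finset τ) :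
    MvPolynomial τ K →ₐ[K] MvPolynomial {v // v ∉ s} K :=
  aeval (fun v => if h : v ∈ s then 0 else X ⟨v, h⟩)

lemma ferrKill_surj (K : Type*) [Field K] {τ : Type*} [DecidableEq τ] (s : Finset τ) :
    Function.Surjective (ferrKill K s) := by
  intro f
  refine ⟨rename Subtype.val f, ?_⟩
  have : (ferrKill K s).comp (rename Subtype.val) = AlgHom.id K _ := by
    apply algHom_ext
    intro v
    simp [ferrKill, v.2]
  exact congrArg (fun g => g f) this

lemma ferrKill_ker (K : Type*) [Field K] {τ : Type*} [DecidableEq τ] (s : Finset τ) :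
    RingHom.ker (ferrKill K s) = Ideal.span (X '' (s : Set τ)) := by
  apply le_antisymm
  · intro f hf
    have h : ((Ideal.Quotient.mkₐ K (Ideal.span (X '' (s : Set τ)))).comp
        (rename Subtype.val)).comp (ferrKill K s) = Ideal.Quotient.mkₐ K _ := by
      apply algHom_ext
      intro v
      by_cases hv : v ∈ s
      · have : Ideal.Quotient.mk (Ideal.span (X '' (s : Set τ))) (X v : MvPolynomial τ K) = 0 := by
          rw [Ideal.Quotient.eq_zero_iff_mem]
          exact Ideal.subset_span ⟨v, hv, rfl⟩
        simp [ferrKill, hv, this]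
      · simp [ferrKill, hv]
    have h2 := congrArg (fun g => g f) h
    have hf' : ferrKill K s f = 0 := hf
    simp only [AlgHom.comp_apply, hf', map_zero] at h2
    exact Ideal.Quotient.eq_zero_iff_mem.mp h2.symm
  · rw [Ideal.span_le]
    rintro _ ⟨v, hv, rfl⟩
    have hv' : v ∈ s := hv
    simp [ferrKill, hv']

lemma ferr_span_prime (K : Type*) [Field K] {τ : Type*} [DecidableEq τ] (s : Finset τ) :
    (Ideal.span (X '' (s : Set τ)) : Ideal (MvPolynomial τ K)).IsPrime := by
  rw [← ferrKill_ker]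
  exact RingHom.ker_isPrime _

lemma ferr_span_dim (K : Type*) [Field K] {τ : Type*} [Fintype τ] [DecidableEq τ] (s : Finset τ) :
    ringKrullDim (MvPolynomial τ K ⧸ (Ideal.span (X '' (s : Set τ)) : Ideal (MvPolynomial τ K)))
      = ((sᶜ).card : ℕ) := by
  rw [← ferrKill_ker]
  refine (ringKrullDim_eq_of_ringEquiv
    (Ideal.quotientKerAlgEquivOfSurjective (ferrKill_surj K s)).toRingEquiv).trans ?_
  rw [MvPolynomial.ringKrullDim_of_isNoetherianRing, ringKrullDim_eq_zero_of_field, zero_add,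
    Nat.card_eq_fintype_card, Fintype.card_subtype]
  congr 3
  ext v; simp

variable {n : ℕ}

/-- The vertex cover attached to `k`. -/
def ferrCov (E : Finset (Fin n × Fin n)) (k : ℕ) : Finset (Fin n ⊕ Fin n) :=
  (Finset.univ.filter (fun i : Fin n => i.val < k)).disjSum
    (Finset.univ.filter (fun j : Fin n => ∃ i : Fin n, i.val = k ∧ (i, j) ∈ E))

lemma ferrCov_inl (E : Finset (Fin n × Fin n)) (k : ℕ) (i : Fin n) :
    Sum.inl i ∈ ferrCov E k ↔ i.val < k := by simp [ferrCov]

lemma ferrCov_inr (E : Finset (Fin n × Fin n)) (k : ℕ) (j : Fin n) :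
    Sum.inr j ∈ ferrCov E k ↔ ∃ i : Fin n, i.val = k ∧ (i, j) ∈ E := by simp [ferrCov]

lemma ferrCov_inr' (E : Finset (Fin n × Fin n)) (k j : Fin n) :
    Sum.inr j ∈ ferrCov E k ↔ (k, j) ∈ E := by
  rw [ferrCov_inr]
  constructor
  · rintro ⟨i, hi, h⟩
    rwa [Fin.ext hi] at h
  · intro h; exact ⟨k, rfl, h⟩

/-- The edge ideal. -/
noncomputable def ferrI (K : Type*) [Field K] (E : Finset (Fin n × Fin n)) :
    Ideal (MvPolynomial (Fin n ⊕ Fin n) K) :=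
  Ideal.span {p | ∃ e ∈ E, p = MvPolynomial.X (Sum.inl e.1) * MvPolynomial.X (Sum.inr e.2)}

/-- The monomial prime attached to `k`. -/
noncomputable def ferrP (K : Type*) [Field K] (E : Finset (Fin n × Fin n)) (k : ℕ) :
    Ideal (MvPolynomial (Fin n ⊕ Fin n) K) :=
  Ideal.span (X '' (ferrCov E k : Set (Fin n ⊕ Fin n)))

lemma ferrI_mem (K : Type*) [Field K] (E : Finset (Fin n × Fin n))
    (f : MvPolynomial (Fin n ⊕ Fin n) K) :
    f ∈ ferrI K E ↔ ∀ m ∈ f.support, ∃ e ∈ E, m (Sum.inl e.1) ≠ 0 ∧ m (Sum.inr e.2) ≠ 0 := by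
  have h : ferrI K E = Ideal.span ((fun s => monomial s (1 : K)) ''
      {s | ∃ e ∈ E, s = Finsupp.single (Sum.inl e.1) 1 + Finsupp.single (Sum.inr e.2) 1}) := by
    unfold ferrI
    congr 1
    ext p
    constructor
    · rintro ⟨e, he, rfl⟩
      exact ⟨_, ⟨e, he, rfl⟩, by simp [X, monomial_mul]⟩
    · rintro ⟨_, ⟨e, he, rfl⟩, rfl⟩
      exact ⟨e, he, by simp [X, monomial_mul]⟩
  rw [h, mem_ideal_span_monomial_image]
  refine forall₂_congr fun m hm => ?_
  constructor
  · rintro ⟨_, ⟨e, he, rfl⟩, hle⟩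
    refine ⟨e, he, ?_, ?_⟩
    · have := hle (Sum.inl e.1)
      simp at this; omega
    · have := hle (Sum.inr e.2)
      simp at this; omega
  · rintro ⟨e, he, h1, h2⟩
    refine ⟨_, ⟨e, he, rfl⟩, ?_⟩
    intro v
    rcases v with v | v
    · by_cases hv : e.1 = v
      · subst hv; simp; omega
      · simp [hv]
    · by_cases hv : e.2 = v
      · subst hv; simp; omega
      · simp [hv]

lemma ferrI_le_P (K : Type*) [Field K] (E : Finset (Fin n × Fin n))
    (hF : ∀ i j p q : Fin n, (i, j) ∈ E → p ≤ i → q ≤ j → (p, q) ∈ E) (k : ℕ) :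
    ferrI K E ≤ ferrP K E k := by
  unfold ferrI
  rw [Ideal.span_le]
  rintro _ ⟨⟨i, j⟩, he, rfl⟩
  by_cases hi : i.val < k
  · exact Ideal.mul_mem_right _ _ (Ideal.subset_span ⟨_, (ferrCov_inl E k i).mpr hi, rfl⟩)
  · refine Ideal.mul_mem_left _ _ (Ideal.subset_span ⟨_, (ferrCov_inr E k j).mpr ?_, rfl⟩)
    exact ⟨⟨k, by omega⟩, rfl, hF i j _ _ he (by rw [Fin.le_def]; simp; omega) le_rfl⟩

lemma ferr_mem_I_of_P (K : Type*) [Field K] (E : Finset (Fin n × Fin n))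
    (f : MvPolynomial (Fin n ⊕ Fin n) K) (hf : ∀ k ≤ n, f ∈ ferrP K E k) : f ∈ ferrI K E := by
  classical
  rw [ferrI_mem]
  intro m hm
  have hP : ∀ k ≤ n, ∃ v ∈ ferrCov E k, m v ≠ 0 := by
    intro k hk
    exact mem_ideal_span_X_image.mp (hf k hk) m hm
  have hex : ∃ k : ℕ, ∃ i : Fin n, i.val = k ∧ m (Sum.inl i) ≠ 0 := by
    obtain ⟨v, hv, hmv⟩ := hP n le_rfl
    rcases v with i | j
    · exact ⟨_, i, rfl, hmv⟩
    · obtain ⟨i, hi, -⟩ := (ferrCov_inr E n j).mp hv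
      exact absurd i.2 (by omega)
  obtain ⟨i, hi, hmi⟩ := Nat.find_spec hex
  obtain ⟨v, hv, hmv⟩ := hP i.val i.2.le
  rcases v with i' | j
  · exact absurd ⟨i', rfl, hmv⟩ (Nat.find_min hex (m := i'.val)
      (by have := (ferrCov_inl E i i').mp hv; omega))
  · exact ⟨(i, j), (ferrCov_inr' E i j).mp hv, hmi, hmv⟩

lemma ferr_coeff_single (K : Type*) [Field K] (E : Finset (Fin n × Fin n))
    (f : MvPolynomial (Fin n ⊕ Fin n) K) (hf : f ∈ ferrI K E) (v : Fin n ⊕ Fin n) :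
    coeff (Finsupp.single v 1) f = 0 := by
  by_contra h
  obtain ⟨e, he, h1, h2⟩ := (ferrI_mem K E f).mp hf _ (mem_support_iff.mpr h)
  rcases v with v | v
  · simp at h2
  · simp at h1

lemma ferr_irr (K : Type*) [Field K] {τ : Type*} [Fintype τ] [DecidableEq τ]
    (I : Ideal (MvPolynomial τ K)) :
    irrelevantIdeal K I = (Ideal.span (X '' ((Finset.univ : Finset τ) : Set τ))).map
      (Ideal.Quotient.mk I) := by
  unfold irrelevantIdeal
  rw [Ideal.map_span]
  congr 1
  simp only [Finset.coe_univ, Set.image_univ]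
  exact Set.range_comp _ _

lemma ferrI_le_vars (K : Type*) [Field K] (E : Finset (Fin n × Fin n)) :
    ferrI K E ≤ Ideal.span (X '' ((Finset.univ : Finset (Fin n ⊕ Fin n)) : Set _)) := by
  unfold ferrI
  rw [Ideal.span_le]
  rintro _ ⟨⟨i, j⟩, he, rfl⟩
  exact Ideal.mul_mem_right _ _ (Ideal.subset_span ⟨_, Finset.mem_coe.mpr (Finset.mem_univ _), rfl⟩)

lemma ferr_irr_prime (K : Type*) [Field K] (E : Finset (Fin n × Fin n)) :
    (irrelevantIdeal K (ferrI K E)).IsPrime := by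
  rw [ferr_irr]
  have := ferr_span_prime K (Finset.univ : Finset (Fin n ⊕ Fin n))
  exact Ideal.map_isPrime_of_surjective Ideal.Quotient.mk_surjective
    (by rw [Ideal.mk_ker]; exact ferrI_le_vars K E)

lemma ferr_mem_irr (K : Type*) [Field K] (E : Finset (Fin n × Fin n))
    (f : MvPolynomial (Fin n ⊕ Fin n) K) (hf : constantCoeff f = 0) :
    Ideal.Quotient.mk (ferrI K E) f ∈ irrelevantIdeal K (ferrI K E) := by
  rw [ferr_irr]
  apply Ideal.mem_map_of_mem
  rw [mem_ideal_span_X_image]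
  intro m hm
  by_contra hcon
  push Not at hcon
  have : m = 0 := by ext v; exact hcon v (by simp)
  rw [this, mem_support_iff] at hm
  exact hm hf

lemma ferr_depth_corner (K : Type*) [Field K] (E : Finset (Fin n × Fin n))
    (hF : ∀ i j p q : Fin n, (i, j) ∈ E → p ≤ i → q ≤ j → (p, q) ∈ E)
    (a b : Fin n) (hab : (a, b) ∈ E) (ha : ∀ i, (i, b) ∈ E → i ≤ a)
    (rs : List (MvPolynomial (Fin n ⊕ Fin n) K ⧸ ferrI K E))
    (hm : ∀ r ∈ rs, r ∈ irrelevantIdeal K (ferrI K E))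
    (hrs : RingTheory.Sequence.IsRegular (MvPolynomial (Fin n ⊕ Fin n) K ⧸ ferrI K E) rs) :
    rs.length ≤ ((ferrCov E a)ᶜ).card := by
  have := ferr_irr_prime K E
  set π := Ideal.Quotient.mk (ferrI K E) with hπ
  let W : Finset (Fin n ⊕ Fin n) := insert (Sum.inl a) (ferrCov E a)
  have hW : (Wᶜ).card + 1 = ((ferrCov E a)ᶜ).card := by
    have h1 : Sum.inl a ∉ ferrCov E a := by rw [ferrCov_inl]; omega
    rw [Finset.card_compl, Finset.card_compl, Finset.card_insert_of_notMem h1]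
    have h2 : (insert (Sum.inl a) (ferrCov E a)).card ≤ Fintype.card (Fin n ⊕ Fin n) :=
      Finset.card_le_univ _
    rw [Finset.card_insert_of_notMem h1] at h2
    omega
  rw [← hW]
  have hzero : ∀ i j, (i, j) ∈ E → π (X (Sum.inl i) * X (Sum.inr j)) = 0 := by
    intro i j hij
    rw [hπ, Ideal.Quotient.eq_zero_iff_mem]
    exact Ideal.subset_span ⟨(i, j), hij, rfl⟩
  refine ferr_depth_bound (irrelevantIdeal K (ferrI K E))
    ((Ideal.span (X '' (W : Set (Fin n ⊕ Fin n)))).map π)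
    (π (X (Sum.inl a) + X (Sum.inr b))) (π (X (Sum.inl a))) ?_ ?_ ?_ ?_ _ ?_ rs hm hrs
  · apply ferr_mem_irr
    simp
  · rw [isSMulRegular_iff_right_eq_zero_of_smul]
    intro f hf
    obtain ⟨f, rfl⟩ := Ideal.Quotient.mk_surjective f
    rw [smul_eq_mul, hπ, ← map_mul, Ideal.Quotient.eq_zero_iff_mem] at hf
    rw [Ideal.Quotient.eq_zero_iff_mem]
    apply ferr_mem_I_of_P
    intro k hk
    have hp : (ferrP K E k).IsPrime := ferr_span_prime K _
    refine (hp.mem_or_mem (ferrI_le_P K E hF k hf)).resolve_left ?_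
    intro h
    have h' := mem_ideal_span_X_image.mp h
    have hne : (Sum.inl a : Fin n ⊕ Fin n) ≠ Sum.inr b := by simp
    have e1 : Finsupp.single (Sum.inl a : Fin n ⊕ Fin n) 1 ≠ Finsupp.single (Sum.inr b) 1 := by
      intro h
      rw [Finsupp.single_left_inj one_ne_zero] at h
      exact hne h
    obtain ⟨v, hv, hv'⟩ := h' (Finsupp.single (Sum.inl a) 1) (by
      rw [mem_support_iff, coeff_add, coeff_X, coeff_X, if_neg e1.symm]; simp)
    obtain ⟨w, hw, hw'⟩ := h' (Finsupp.single (Sum.inr b) 1) (by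
      rw [mem_support_iff, coeff_add, coeff_X, coeff_X, if_neg e1]; simp)
    rw [Finsupp.single_apply_ne_zero] at hv' hw'
    rw [hv'.1] at hv
    rw [hw'.1] at hw
    have h1 := (ferrCov_inl E k a).mp hv
    obtain ⟨i, hi, hib⟩ := (ferrCov_inr E k b).mp hw
    have := ha i hib
    rw [Fin.le_def] at this
    omega
  · have key : (Ideal.span (X '' (W : Set (Fin n ⊕ Fin n)))).map π ≤
        Submodule.comap (LinearMap.toSpanSingleton _ _ (π (X (Sum.inl a))))
          (Ideal.span {π (X (Sum.inl a) + X (Sum.inr b))}) := by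
      rw [Ideal.map_span, Ideal.span_le]
      rintro _ ⟨_, ⟨v, hv, rfl⟩, rfl⟩
      simp only [SetLike.mem_coe, Submodule.mem_comap, LinearMap.toSpanSingleton_apply, smul_eq_mul]
      have hl : ∀ i, i ≤ a → π (X (Sum.inl i)) * π (X (Sum.inl a)) ∈
          Ideal.span {π (X (Sum.inl a) + X (Sum.inr b))} := by
        intro i hi
        rw [Ideal.mem_span_singleton]
        refine ⟨π (X (Sum.inl i)), ?_⟩
        have := hzero i b (hF a b i b hab hi le_rfl)
        rw [map_mul] at this
        rw [map_add]
        linear_combination -this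
      rcases Finset.mem_insert.mp hv with rfl | hv
      · exact hl a le_rfl
      · rcases v with i | j
        · exact hl i (by have := (ferrCov_inl E a i).mp hv; rw [Fin.le_def]; omega)
        · have := hzero a j ((ferrCov_inr' E a j).mp hv)
          rw [← map_mul, mul_comm, this]
          exact zero_mem _
    intro j hj
    exact key hj
  · intro s hs h
    obtain ⟨f, rfl⟩ := Ideal.Quotient.mk_surjective s
    obtain ⟨g, hg⟩ := Ideal.mem_span_singleton.mp h
    obtain ⟨g, rfl⟩ := Ideal.Quotient.mk_surjective g
    rw [hπ, ← map_mul, ← map_mul, Ideal.Quotient.eq] at hg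
    apply hs
    apply ferr_mem_irr
    have h1 := ferr_coeff_single K E _ hg (Sum.inl a)
    have h2 := ferr_coeff_single K E _ hg (Sum.inr b)
    rw [add_mul, coeff_sub, coeff_add, mul_comm (X (Sum.inl a)) g, mul_comm (X (Sum.inr b)) g,
      coeff_mul_X', coeff_mul_X', coeff_mul_X'] at h1 h2
    simp only [Finsupp.support_single _ one_ne_zero, Finset.mem_singleton, reduceCtorEq,
      if_true, if_false, tsub_self] at h1 h2
    rw [constantCoeff_eq]
    linear_combination h1 - h2
  · refine le_trans (ringKrullDim_le_of_surjective
      (Ideal.quotientMap ((Ideal.span (X '' (W : Set (Fin n ⊕ Fin n)))).map π) π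
        Ideal.le_comap_map)
      (Ideal.quotientMap_surjective Ideal.Quotient.mk_surjective)) ?_
    rw [ferr_span_dim]

lemma ferr_depth_le (K : Type*) [Field K] (E : Finset (Fin n × Fin n))
    (hF : ∀ i j p q : Fin n, (i, j) ∈ E → p ≤ i → q ≤ j → (p, q) ∈ E)
    (hx : ∀ i : Fin n, ∃ j, (i, j) ∈ E) (a : Fin n) :
    idealDepth (irrelevantIdeal K (ferrI K E)) ≤ (((ferrCov E a)ᶜ).card : ℕ) := by
  apply sSup_le
  rintro _ ⟨rs, rfl, hm, hrs⟩
  obtain ⟨b, hb, hbmax⟩ := (Finset.univ.filter (fun j => (a, j) ∈ E)).exists_max_image id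
    (by obtain ⟨j, hj⟩ := hx a; exact ⟨j, by simp [hj]⟩)
  obtain ⟨a', ha', hamax⟩ := (Finset.univ.filter (fun i => (i, b) ∈ E)).exists_max_image id
    ⟨a, by simpa using hb⟩
  simp only [Finset.mem_filter, Finset.mem_univ, true_and, id] at hb hbmax ha' hamax
  have h := ferr_depth_corner K E hF a' b ha' hamax rs hm hrs
  have hle : ((ferrCov E a')ᶜ).card ≤ ((ferrCov E a)ᶜ).card := by
    apply Finset.card_le_card
    rw [Finset.compl_subset_compl]
    intro v hv
    have haa := hamax a hb
    rcases v with i | j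
    · rw [ferrCov_inl] at hv ⊢
      rw [Fin.le_def] at haa
      omega
    · rw [ferrCov_inr'] at hv ⊢
      exact hF a' b a' j ha' le_rfl (hbmax j hv)
  exact_mod_cast h.trans hle

lemma ferr_le_dim (K : Type*) [Field K] (E : Finset (Fin n × Fin n))
    (hF : ∀ i j p q : Fin n, (i, j) ∈ E → p ≤ i → q ≤ j → (p, q) ∈ E) (k : ℕ) :
    (((ferrCov E k)ᶜ).card : WithBot ℕ∞) ≤
      ringKrullDim (MvPolynomial (Fin n ⊕ Fin n) K ⧸ ferrI K E) := by
  have h := ringKrullDim_le_of_surjective (Ideal.Quotient.factor (ferrI_le_P K E hF k))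
    (Ideal.Quotient.factor_surjective _)
  unfold ferrP at h
  rwa [ferr_span_dim] at h

lemma ferr_dim_le (K : Type*) [Field K] (E : Finset (Fin n × Fin n)) (c : ℕ)
    (hc : ∀ k ≤ n, ((ferrCov E k)ᶜ).card ≤ c) :
    ringKrullDim (MvPolynomial (Fin n ⊕ Fin n) K ⧸ ferrI K E) ≤ c := by
  rw [ringKrullDim_quotient]
  apply iSup_le
  intro p
  have hp : ∃ k ≤ n, ferrP K E k ≤ p.head.1.asIdeal := by
    have h1 : (Finset.range (n + 1)).inf (fun k => ferrP K E k) ≤ p.head.1.asIdeal := by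
      intro f hf
      apply p.head.2
      apply ferr_mem_I_of_P
      intro k hk
      exact (Finset.inf_le (f := fun k => ferrP K E k) (Finset.mem_range.mpr (by omega))) hf
    obtain ⟨k, hk, h2⟩ := (Ideal.IsPrime.inf_le' p.head.1.isPrime).mp h1
    exact ⟨k, by have := Finset.mem_range.mp hk; omega, h2⟩
  obtain ⟨k, hk, hle⟩ := hp
  have h3 := ferr_span_dim K (ferrCov E k)
  rw [ringKrullDim_quotient] at h3
  have hz : ∀ i, (p i).1 ∈ PrimeSpectrum.zeroLocus
      ((Ideal.span (X '' (ferrCov E k : Set (Fin n ⊕ Fin n))) :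
        Ideal (MvPolynomial (Fin n ⊕ Fin n) K)) : Set (MvPolynomial (Fin n ⊕ Fin n) K)) := by
    intro i f hf
    have h4 : p.head ≤ p i := p.monotone (Fin.zero_le _)
    exact h4 (hle hf)
  let q : LTSeries (PrimeSpectrum.zeroLocus
      ((Ideal.span (X '' (ferrCov E k : Set (Fin n ⊕ Fin n))) :
        Ideal (MvPolynomial (Fin n ⊕ Fin n) K)) : Set (MvPolynomial (Fin n ⊕ Fin n) K))) :=
    { length := p.length
      toFun := fun i => ⟨(p i).1, hz i⟩
      step := fun i => p.step i }
  have h5 := Order.LTSeries.length_le_krullDim q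
  rw [h3] at h5
  refine le_trans h5 ?_
  exact_mod_cast hc k hk

end Monomial
section Regular

open MvPolynomial

variable {n : ℕ}

/-- The linear forms. -/
noncomputable def ferrTheta (K : Type*) [Field K] (E : Finset (Fin n × Fin n)) (i : Fin n) :
    MvPolynomial (Fin n ⊕ Fin n) K ⧸ ferrI K E :=
  Ideal.Quotient.mk (ferrI K E) (X (Sum.inl i) - X (Sum.inr (Fin.rev i)))

/-- The map from the polynomial ring given by the linear forms. -/
noncomputable def ferrPhi (K : Type*) [Field K] (E : Finset (Fin n × Fin n)) :
    MvPolynomial (Fin n) K →ₐ[K] MvPolynomial (Fin n ⊕ Fin n) K ⧸ ferrI K E :=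
  aeval (ferrTheta K E)

/-- The generators. -/
noncomputable def ferrGen (K : Type*) [Field K] (E : Finset (Fin n × Fin n)) :
    Option (Fin n) → MvPolynomial (Fin n ⊕ Fin n) K ⧸ ferrI K E
  | none => 1
  | some k => Ideal.Quotient.mk (ferrI K E) (X (Sum.inl k))

/-- The component maps. -/
noncomputable def ferrRho0 (K : Type*) [Field K] (k : ℕ) :
    MvPolynomial (Fin n ⊕ Fin n) K →ₐ[K] MvPolynomial (Fin n) K :=
  aeval (Sum.elim (fun i : Fin n => if i.val < k then 0 else X i)
    (fun j : Fin n => if (Fin.rev j).val < k then - X (Fin.rev j) else 0))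

lemma ferrRho0_zero (K : Type*) [Field K] (E : Finset (Fin n × Fin n))
    (hE : ∀ i j : Fin n, (i, j) ∈ E ↔ i.val + j.val < n) (k : ℕ)
    (f : MvPolynomial (Fin n ⊕ Fin n) K) (hf : f ∈ ferrI K E) : ferrRho0 K k f = 0 := by
  have h : ferrI K E ≤ RingHom.ker (ferrRho0 (n := n) K k) := by
    unfold ferrI
    rw [Ideal.span_le]
    rintro _ ⟨⟨i, j⟩, he, rfl⟩
    rw [hE] at he
    simp only [SetLike.mem_coe, RingHom.mem_ker, ferrRho0, map_mul, aeval_X, Sum.elim_inl,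
      Sum.elim_inr, Fin.val_rev]
    split_ifs with h1 h2
    · simp
    · simp
    · omega
    · simp
  exact h hf

/-- The component maps on the quotient. -/
noncomputable def ferrRho (K : Type*) [Field K] (E : Finset (Fin n × Fin n))
    (hE : ∀ i j : Fin n, (i, j) ∈ E ↔ i.val + j.val < n) (k : ℕ) :
    MvPolynomial (Fin n ⊕ Fin n) K ⧸ ferrI K E →ₐ[K] MvPolynomial (Fin n) K :=
  Ideal.Quotient.liftₐ (ferrI K E) (ferrRho0 K k) (ferrRho0_zero K E hE k)

lemma ferrRho_mk (K : Type*) [Field K] (E : Finset (Fin n × Fin n))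
    (hE : ∀ i j : Fin n, (i, j) ∈ E ↔ i.val + j.val < n) (k : ℕ)
    (f : MvPolynomial (Fin n ⊕ Fin n) K) :
    ferrRho K E hE k (Ideal.Quotient.mk _ f) = ferrRho0 K k f := rfl

lemma ferrRho_phi (K : Type*) [Field K] (E : Finset (Fin n × Fin n))
    (hE : ∀ i j : Fin n, (i, j) ∈ E ↔ i.val + j.val < n) (k : ℕ)
    (f : MvPolynomial (Fin n) K) : ferrRho K E hE k (ferrPhi K E f) = f := by
  have : (ferrRho K E hE k).comp (ferrPhi K E) = AlgHom.id K _ := by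
    apply algHom_ext
    intro i
    simp only [AlgHom.comp_apply, ferrPhi, aeval_X, ferrTheta, ferrRho_mk, ferrRho0, map_sub,
      Sum.elim_inl, Sum.elim_inr, Fin.rev_rev, AlgHom.id_apply]
    split_ifs <;> simp
  exact congrArg (fun g => g f) this

lemma ferr_indep (K : Type*) [Field K] (E : Finset (Fin n × Fin n))
    (hE : ∀ i j : Fin n, (i, j) ∈ E ↔ i.val + j.val < n)
    (g : Option (Fin n) → MvPolynomial (Fin n) K)
    (hg : ∑ i, ferrPhi K E (g i) * ferrGen K E i = 0) : ∀ i, g i = 0 := by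
  have hk : ∀ k : ℕ, g none + ∑ j : Fin n, g (some j) * (if j.val < k then 0 else X j) = 0 := by
    intro k
    have := congrArg (ferrRho K E hE k) hg
    rw [map_zero, map_sum, Fintype.sum_option] at this
    simpa only [map_mul, ferrRho_phi, ferrGen, map_one, mul_one, ferrRho_mk, ferrRho0, aeval_X,
      Sum.elim_inl] using this
  intro i
  rcases i with _ | i
  · have := hk n
    simpa using this
  · have h1 := hk i.val
    have h2 := hk (i.val + 1)
    have h3 : ∑ j : Fin n, (g (some j) * (if j.val < i.val then 0 else X j)
        - g (some j) * (if j.val < i.val + 1 then 0 else X j)) = 0 := by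
      rw [Finset.sum_sub_distrib]
      linear_combination h1 - h2
    rw [Finset.sum_eq_single i] at h3
    · simpa using h3
    · intro j _ hj
      have : j.val ≠ i.val := fun h => hj (Fin.ext h)
      by_cases h : j.val < i.val
      · simp [h, Nat.lt_succ_of_lt h]
      · have h' : ¬ j.val < i.val + 1 := by omega
        simp only [if_neg h, if_neg h', sub_self]
    · simp

lemma ferr_free (K : Type*) [Field K] (E : Finset (Fin n × Fin n))
    (hE : ∀ i j : Fin n, (i, j) ∈ E ↔ i.val + j.val < n) :
    letI := (ferrPhi K E).toRingHom.toAlgebra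
    letI : Module (MvPolynomial (Fin n) K) (MvPolynomial (Fin n ⊕ Fin n) K ⧸ ferrI K E) :=
      Algebra.toModule
    Module.Free (MvPolynomial (Fin n) K) (MvPolynomial (Fin n ⊕ Fin n) K ⧸ ferrI K E) := by
  let _ := (ferrPhi K E).toRingHom.toAlgebra
  let _ : Module (MvPolynomial (Fin n) K) (MvPolynomial (Fin n ⊕ Fin n) K ⧸ ferrI K E) :=
    Algebra.toModule
  have hsm : ∀ (b : MvPolynomial (Fin n) K) (a : MvPolynomial (Fin n ⊕ Fin n) K ⧸ ferrI K E),
      b • a = ferrPhi K E b * a := fun b a => rfl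
  have hli : LinearIndependent (MvPolynomial (Fin n) K) (ferrGen K E) := by
    rw [Fintype.linearIndependent_iff]
    intro g hg
    exact ferr_indep K E hE g hg
  set M := Submodule.span (MvPolynomial (Fin n) K) (Set.range (ferrGen K E)) with hM
  have hgen : ∀ k, ferrGen K E k ∈ M := fun k => Submodule.subset_span ⟨k, rfl⟩
  have hxx : ∀ k i : Fin n, k ≤ i → Ideal.Quotient.mk (ferrI K E) (X (Sum.inl k)) *
      Ideal.Quotient.mk (ferrI K E) (X (Sum.inl i)) ∈ M := by
    intro k i hki
    have h : Ideal.Quotient.mk (ferrI K E) (X (Sum.inl k) * X (Sum.inr (Fin.rev i))) = 0 := by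
      rw [Ideal.Quotient.eq_zero_iff_mem]
      refine Ideal.subset_span ⟨(k, Fin.rev i), ?_, rfl⟩
      rw [hE, Fin.val_rev]
      rw [Fin.le_def] at hki
      omega
    have h2 : Ideal.Quotient.mk (ferrI K E) (X (Sum.inl k)) *
      Ideal.Quotient.mk (ferrI K E) (X (Sum.inl i)) = (X i : MvPolynomial (Fin n) K) •
        ferrGen K E (some k) := by
      rw [hsm, ferrPhi, aeval_X, ferrTheta, ferrGen, map_sub]
      rw [map_mul] at h
      linear_combination h
    rw [h2]
    exact M.smul_mem _ (hgen _)
  have hmx : ∀ i : Fin n, ∀ m ∈ M, m * Ideal.Quotient.mk (ferrI K E) (X (Sum.inl i)) ∈ M := by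
    intro i m hm
    induction hm using Submodule.span_induction with
    | mem x hx =>
      obtain ⟨k, rfl⟩ := hx
      rcases k with _ | k
      · have := hgen (some i)
        simpa [ferrGen] using this
      · rcases le_total k i with h | h
        · exact hxx k i h
        · rw [mul_comm]; exact hxx i k h
    | zero => simp
    | add x y _ _ hx hy => rw [add_mul]; exact M.add_mem hx hy
    | smul b x _ hx => rw [hsm, mul_assoc, ← hsm]; exact M.smul_mem _ hx
  have hmz : ∀ j : Fin n, ∀ m ∈ M, m * Ideal.Quotient.mk (ferrI K E) (X (Sum.inr j)) ∈ M := by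
    intro j m hm
    have h2 : m * Ideal.Quotient.mk (ferrI K E) (X (Sum.inr j)) =
        m * Ideal.Quotient.mk (ferrI K E) (X (Sum.inl (Fin.rev j))) -
        (X (Fin.rev j) : MvPolynomial (Fin n) K) • m := by
      rw [hsm, ferrPhi, aeval_X, ferrTheta, Fin.rev_rev, map_sub]
      ring
    rw [h2]
    exact M.sub_mem (hmx _ m hm) (M.smul_mem _ hm)
  have htop : ⊤ ≤ M := by
    intro a _
    obtain ⟨f, rfl⟩ := Ideal.Quotient.mk_surjective a
    induction f using MvPolynomial.induction_on with
    | C a =>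
      have h2 : Ideal.Quotient.mk (ferrI K E) (C a) = (C a : MvPolynomial (Fin n) K) •
          ferrGen K E none := by
        rw [hsm, ferrPhi, aeval_C, ferrGen, mul_one]
        rfl
      rw [h2]
      exact M.smul_mem _ (hgen _)
    | add p q hp hq => rw [map_add]; exact M.add_mem (hp trivial) (hq trivial)
    | mul_X p v hp =>
      rw [map_mul]
      rcases v with i | j
      · exact hmx i _ (hp trivial)
      · exact hmz j _ (hp trivial)
  exact Module.Free.of_basis (Module.Basis.mk hli htop)

lemma ferr_X_weak (K : Type*) [Field K] :
    RingTheory.Sequence.IsWeaklyRegular (MvPolynomial (Fin n) K)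
      ((List.finRange n).map (X : Fin n → MvPolynomial (Fin n) K)) := by
  constructor
  intro i hi
  have hin : i < n := by simpa using hi
  let s : Finset (Fin n) := Finset.univ.filter (fun j => j.val < i)
  have hs : (Ideal.ofList (((List.finRange n).map (X : Fin n → MvPolynomial (Fin n) K)).take i) •
      ⊤ : Ideal (MvPolynomial (Fin n) K)) = Ideal.span (X '' (s : Set (Fin n))) := by
    rw [smul_eq_mul, Ideal.mul_top, Ideal.ofList]
    congr 1
    ext p
    simp only [← List.map_take, List.mem_map, Set.mem_ofPred_eq, Set.mem_image, Finset.mem_coe]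
    refine exists_congr fun j => and_congr_left fun _ => ?_
    simp only [s, Finset.mem_filter, Finset.mem_univ, true_and, List.mem_take_iff_getElem]
    constructor
    · rintro ⟨k, hk, rfl⟩
      simp at hk ⊢; omega
    · intro hj
      exact ⟨j.val, by simp [hj], by simp⟩
  rw [hs, isSMulRegular_iff_right_eq_zero_of_smul]
  intro f hf
  obtain ⟨f, rfl⟩ := Submodule.Quotient.mk_surjective _ f
  rw [← Submodule.Quotient.mk_smul, Submodule.Quotient.mk_eq_zero] at hf
  rw [Submodule.Quotient.mk_eq_zero]
  refine ((ferr_span_prime K s).mem_or_mem hf).resolve_left ?_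
  intro h
  obtain ⟨v, hv, hv'⟩ := mem_ideal_span_X_image.mp h (Finsupp.single ⟨i, hin⟩ 1) (by
    simp)
  rw [Finsupp.single_apply_ne_zero] at hv'
  rw [hv'.1] at hv
  simp [s] at hv

lemma ferr_le_depth (K : Type*) [Field K] (E : Finset (Fin n × Fin n))
    (hE : ∀ i j : Fin n, (i, j) ∈ E ↔ i.val + j.val < n) :
    (n : ℕ∞) ≤ idealDepth (irrelevantIdeal K (ferrI K E)) := by
  let _ := (ferrPhi K E).toRingHom.toAlgebra
  let _ : Module (MvPolynomial (Fin n) K) (MvPolynomial (Fin n ⊕ Fin n) K ⧸ ferrI K E) :=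
    Algebra.toModule
  have hfree : Module.Free (MvPolynomial (Fin n) K)
      (MvPolynomial (Fin n ⊕ Fin n) K ⧸ ferrI K E) := ferr_free K E hE
  have hw := RingTheory.Sequence.IsWeaklyRegular.of_flat
    (S := MvPolynomial (Fin n ⊕ Fin n) K ⧸ ferrI K E) (ferr_X_weak (n := n) K)
  have hmem : ∀ r ∈ ((List.finRange n).map (X : Fin n → MvPolynomial (Fin n) K)).map
      (algebraMap (MvPolynomial (Fin n) K) (MvPolynomial (Fin n ⊕ Fin n) K ⧸ ferrI K E)),
      r ∈ irrelevantIdeal K (ferrI K E) := by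
    intro r hr
    simp only [List.mem_map] at hr
    obtain ⟨_, ⟨i, -, rfl⟩, rfl⟩ := hr
    have : algebraMap (MvPolynomial (Fin n) K) (MvPolynomial (Fin n ⊕ Fin n) K ⧸ ferrI K E) (X i)
      = ferrTheta K E i := aeval_X _ _
    rw [this]
    apply ferr_mem_irr
    simp
  apply le_sSup
  refine ⟨_, ?_, hmem, hw, ?_⟩
  · simp
  · intro h
    apply (ferr_irr_prime K E).ne_top
    rw [eq_top_iff, h, smul_eq_mul, Ideal.mul_top, Ideal.ofList, Ideal.span_le]
    exact hmem

end Regular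
section Hilbert

open MvPolynomial

variable {n : ℕ}

/-- The standard monomials of degree `d`. -/
def ferrStd (E : Finset (Fin n × Fin n)) (d : ℕ) : Finset ((Fin n ⊕ Fin n) →₀ ℕ) :=
  (Finset.finsuppAntidiag Finset.univ d).filter
    (fun m => ∀ e ∈ E, m (Sum.inl e.1) = 0 ∨ m (Sum.inr e.2) = 0)

lemma ferrStd_mem (E : Finset (Fin n × Fin n)) (d : ℕ) (m : (Fin n ⊕ Fin n) →₀ ℕ) :
    m ∈ ferrStd E d ↔ ∑ v, m v = d ∧ ∀ e ∈ E, m (Sum.inl e.1) = 0 ∨ m (Sum.inr e.2) = 0 := by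
  simp [ferrStd, Finset.mem_finsuppAntidiag]

lemma ferr_hilbertFn (K : Type*) [Field K] (E : Finset (Fin n × Fin n)) (d : ℕ) :
    hilbertFn K (ferrI K E) d = (ferrStd E d).card := by
  let b : ferrStd E d → MvPolynomial (Fin n ⊕ Fin n) K ⧸ ferrI K E :=
    fun m => Ideal.Quotient.mkₐ K (ferrI K E) (monomial m.1 1)
  have hli : LinearIndependent K b := by
    rw [Fintype.linearIndependent_iff]
    intro g hg m
    have h1 : Ideal.Quotient.mkₐ K (ferrI K E)
        (∑ i : ferrStd E d, g i • monomial i.1 (1 : K)) = 0 := by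
      rw [map_sum, ← hg]
      exact Finset.sum_congr rfl fun i _ => map_smul _ _ _
    have h2 : (∑ i : ferrStd E d, g i • monomial i.1 (1 : K)) ∈ ferrI K E :=
      Ideal.Quotient.eq_zero_iff_mem.mp h1
    have h3 : coeff m.1 (∑ i : ferrStd E d, g i • monomial i.1 (1 : K)) = g m := by
      rw [coeff_sum, Finset.sum_eq_single m]
      · simp
      · intro i _ hi
        have : i.1 ≠ m.1 := fun h => hi (Subtype.ext h)
        simp [coeff_monomial, this]
      · simp
    by_contra hne
    rw [← h3] at hne
    obtain ⟨e, he, h4, h5⟩ := (ferrI_mem K E _).mp h2 m.1 (mem_support_iff.mpr hne)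
    rcases ((ferrStd_mem E d m.1).mp m.2).2 e he with h | h
    · exact h4 h
    · exact h5 h
  have hspan : (homogeneousSubmodule (Fin n ⊕ Fin n) K d).map
      (Ideal.Quotient.mkₐ K (ferrI K E)).toLinearMap = Submodule.span K (Set.range b) := by
    apply le_antisymm
    · rintro _ ⟨p, hp, rfl⟩
      have hp' : p.IsHomogeneous d := hp
      rw [p.as_sum, map_sum]
      apply Submodule.sum_mem
      intro m hm
      have hdeg : ∑ v, m v = d := by
        have := hp' (mem_support_iff.mp hm)
        rw [← this, Finsupp.weight_apply, Finsupp.sum_fintype _ _ (by simp)]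
        simp
      by_cases hE : ∀ e ∈ E, m (Sum.inl e.1) = 0 ∨ m (Sum.inr e.2) = 0
      · have : monomial m (coeff m p) = coeff m p • monomial m (1 : K) := by
          rw [smul_monomial, smul_eq_mul, mul_one]
        rw [this, map_smul]
        exact Submodule.smul_mem _ _ (Submodule.subset_span
          ⟨⟨m, (ferrStd_mem E d m).mpr ⟨hdeg, hE⟩⟩, rfl⟩)
      · have h0 : Ideal.Quotient.mkₐ K (ferrI K E) (monomial m (coeff m p)) = 0 := by
          refine Ideal.Quotient.eq_zero_iff_mem.mpr ?_
          rw [ferrI_mem]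
          intro m' hm'
          have := Finset.mem_singleton.mp (support_monomial_subset hm')
          subst this
          push Not at hE
          exact hE
        have h0' : (Ideal.Quotient.mkₐ K (ferrI K E)).toLinearMap (monomial m (coeff m p)) = 0 := h0
        rw [h0']
        exact Submodule.zero_mem _
    · rw [Submodule.span_le]
      rintro _ ⟨m, rfl⟩
      refine ⟨monomial m.1 1, ?_, rfl⟩
      apply isHomogeneous_monomial
      rw [Finsupp.degree_eq_sum]
      exact ((ferrStd_mem E d m.1).mp m.2).1
  unfold hilbertFn
  rw [hspan, finrank_span_eq_card hli, Fintype.card_coe]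

lemma ferr_antidiag_mem (s : Finset (Fin n ⊕ Fin n)) (d : ℕ) (m : (Fin n ⊕ Fin n) →₀ ℕ) :
    m ∈ Finset.finsuppAntidiag sᶜ d ↔ ∑ v, m v = d ∧ ∀ v ∈ s, m v = 0 := by
  rw [Finset.mem_finsuppAntidiag]
  have h : m.support ⊆ sᶜ ↔ ∀ v ∈ s, m v = 0 := by
    constructor
    · intro h v hv
      by_contra hne
      have := h (Finsupp.mem_support_iff.mpr hne)
      simp [hv] at this
    · intro h v hv
      rw [Finset.mem_compl]
      intro hs
      exact Finsupp.mem_support_iff.mp hv (h v hs)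
  rw [h]
  refine and_congr_left fun h' => ?_
  rw [Finset.sum_subset (Finset.subset_univ _)]
  intro v _ hv
  exact h' v (by simpa using hv)

lemma ferrStd_zero (E : Finset (Fin n × Fin n)) : (ferrStd E 0).card = 1 := by
  rw [ferrStd, Finset.finsuppAntidiag_zero, Finset.filter_true_of_mem]
  · simp
  · intro m hm
    simp at hm
    simp [hm]

lemma ferrCov_n (E : Finset (Fin n × Fin n)) : ((ferrCov E n)ᶜ).card = n := by
  have : (ferrCov E n) = Finset.univ.disjSum ∅ := by
    ext v
    rcases v with i | j
    · simp [ferrCov_inl]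
    · rw [ferrCov_inr]
      simp only [Finset.inr_mem_disjSum, Finset.notMem_empty, iff_false]
      rintro ⟨i, hi, -⟩
      exact absurd i.2 (by omega)
  rw [Finset.card_compl, this, Finset.card_disjSum]
  simp

lemma ferrStd_succ (E : Finset (Fin n × Fin n))
    (hF : ∀ i j p q : Fin n, (i, j) ∈ E → p ≤ i → q ≤ j → (p, q) ∈ E) (d : ℕ) :
    (ferrStd E (d + 1)).card = n.multichoose (d + 1) +
      ∑ a : Fin n, (((ferrCov E a)ᶜ).card).multichoose d := by
  classical
  let T : Fin n → Finset ((Fin n ⊕ Fin n) →₀ ℕ) := fun a =>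
    (Finset.finsuppAntidiag (ferrCov E a)ᶜ d).image (· + Finsupp.single (Sum.inl a) 1)
  let T0 : Finset ((Fin n ⊕ Fin n) →₀ ℕ) := Finset.finsuppAntidiag (ferrCov E n)ᶜ (d + 1)
  have hT0 : ∀ m, m ∈ T0 ↔ ∑ v, m v = d + 1 ∧ ∀ i, m (Sum.inl i) = 0 := by
    intro m
    simp only [T0]
    rw [ferr_antidiag_mem]
    refine and_congr_right fun _ => ?_
    constructor
    · intro h i
      exact h _ ((ferrCov_inl E n i).mpr i.2)
    · intro h v hv
      rcases v with i | j
      · exact h i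
      · obtain ⟨i, hi, -⟩ := (ferrCov_inr E n j).mp hv
        exact absurd i.2 (by omega)
  have hT : ∀ a m, m ∈ T a ↔ ∑ v, m v = d + 1 ∧ m (Sum.inl a) ≠ 0 ∧
      (∀ i < a, m (Sum.inl i) = 0) ∧ ∀ j, (a, j) ∈ E → m (Sum.inr j) = 0 := by
    intro a m
    simp only [T, Finset.mem_image, ferr_antidiag_mem]
    constructor
    · rintro ⟨m, ⟨h1, h2⟩, rfl⟩
      refine ⟨?_, ?_, ?_, ?_⟩
      · simp only [Finsupp.add_apply, Finset.sum_add_distrib, h1]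
        rw [Finset.sum_eq_single (Sum.inl a)]
        · simp
        · intro v _ hv
          simp [hv.symm]
        · simp
      · simp
      · intro i hi
        have := h2 _ ((ferrCov_inl E a i).mpr hi)
        simp [this, hi.ne']
      · intro j hj
        have := h2 _ ((ferrCov_inr' E a j).mpr hj)
        simp [this]
    · rintro ⟨h1, h2, h3, h4⟩
      have hle : Finsupp.single (Sum.inl a) 1 ≤ m := by
        rw [Finsupp.single_le_iff]; omega
      have hadd := tsub_add_cancel_of_le hle
      refine ⟨m - Finsupp.single (Sum.inl a) 1, ⟨?_, ?_⟩, hadd⟩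
      · have h5 : ∑ v, (m - Finsupp.single (Sum.inl a) 1 + Finsupp.single (Sum.inl a) 1 :
            (Fin n ⊕ Fin n) →₀ ℕ) v
            = d + 1 := by rw [hadd, h1]
        simp only [Finsupp.add_apply, Finset.sum_add_distrib] at h5
        rw [Finset.sum_eq_single (f := fun v => (Finsupp.single (Sum.inl a) 1 : _ →₀ ℕ) v)
          (Sum.inl a)] at h5
        · simpa using h5
        · intro v _ hv
          simp [hv.symm]
        · simp
      · intro v hv
        rcases v with i | j
        · have := h3 i ((ferrCov_inl E a i).mp hv)
          simp [this]
        · have := h4 j ((ferrCov_inr' E a j).mp hv)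
          simp [this]
  have hunion : ferrStd E (d + 1) = T0 ∪ Finset.univ.biUnion T := by
    ext m
    simp only [Finset.mem_union, Finset.mem_biUnion, Finset.mem_univ, true_and, hT0, hT,
      ferrStd_mem]
    constructor
    · rintro ⟨h1, h2⟩
      by_cases h : ∀ i, m (Sum.inl i) = 0
      · exact Or.inl ⟨h1, h⟩
      · right
        push Not at h
        obtain ⟨i, hi⟩ := h
        obtain ⟨a, ha, hmin⟩ := (Finset.univ.filter (fun i => m (Sum.inl i) ≠ 0)).exists_min_image
          id ⟨i, by simpa using hi⟩
        simp only [Finset.mem_filter, Finset.mem_univ, true_and, id] at ha hmin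
        refine ⟨a, h1, ha, ?_, ?_⟩
        · intro i hia
          by_contra hne
          exact absurd (hmin i hne) (not_le.mpr hia)
        · intro j hj
          exact (h2 (a, j) hj).resolve_left ha
    · rintro (⟨h1, h2⟩ | ⟨a, h1, h2, h3, h4⟩)
      · exact ⟨h1, fun e _ => Or.inl (h2 _)⟩
      · refine ⟨h1, fun e he => ?_⟩
        rcases lt_or_ge e.1 a with h | h
        · exact Or.inl (h3 _ h)
        · exact Or.inr (h4 _ (hF e.1 e.2 a e.2 he h le_rfl))
  have hd1 : Disjoint T0 (Finset.univ.biUnion T) := by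
    rw [Finset.disjoint_left]
    intro m hm hm'
    simp only [Finset.mem_biUnion, Finset.mem_univ, true_and, hT] at hm'
    obtain ⟨a, -, h, -⟩ := hm'
    exact h (((hT0 m).mp hm).2 a)
  have hd2 : ∀ a ∈ (Finset.univ : Finset (Fin n)), ∀ b ∈ (Finset.univ : Finset (Fin n)),
      a ≠ b → Disjoint (T a) (T b) := by
    intro a _ b _ hab
    rw [Finset.disjoint_left]
    intro m hm hm'
    obtain ⟨-, h1, h2, -⟩ := (hT a m).mp hm
    obtain ⟨-, h3, h4, -⟩ := (hT b m).mp hm'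
    rcases lt_or_gt_of_ne hab with h | h
    · exact h1 (h4 a h)
    · exact h3 (h2 b h)
  rw [hunion, Finset.card_union_of_disjoint hd1, Finset.card_biUnion hd2]
  congr 1
  · simp only [T0]
    rw [Finset.card_finsuppAntidiag_nat_eq_multichoose, ferrCov_n]
  · refine Finset.sum_congr rfl fun a _ => ?_
    simp only [T]
    rw [Finset.card_image_of_injective _ (add_left_injective _),
      Finset.card_finsuppAntidiag_nat_eq_multichoose]

end Hilbert
section Series

variable {n : ℕ}

lemma ferr_card (E : Finset (Fin n × Fin n)) (a : Fin n) :
    ((ferrCov E a)ᶜ).card + (a.val + (Finset.univ.filter (fun j => (a, j) ∈ E)).card) = 2 * n := by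
  have h : (ferrCov E a).card = a.val + (Finset.univ.filter (fun j => (a, j) ∈ E)).card := by
    have : ferrCov E a = (Finset.Iio a).disjSum (Finset.univ.filter (fun j => (a, j) ∈ E)) := by
      ext v
      rcases v with i | j
      · rw [ferrCov_inl, Finset.inl_mem_disjSum, Finset.mem_Iio, Fin.lt_def]
      · rw [ferrCov_inr', Finset.inr_mem_disjSum]; simp
    rw [this, Finset.card_disjSum, Fin.card_Iio]
  have h2 : (ferrCov E a).card ≤ Fintype.card (Fin n ⊕ Fin n) := Finset.card_le_univ _
  rw [← h, Finset.card_compl]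
  simp only [Fintype.card_sum, Fintype.card_fin] at h2 ⊢
  omega

lemma ferr_card_zero (hn : 1 ≤ n) (E : Finset (Fin n × Fin n))
    (hF : ∀ i j p q : Fin n, (i, j) ∈ E → p ≤ i → q ≤ j → (p, q) ∈ E)
    (hy : ∀ j : Fin n, ∃ i, (i, j) ∈ E) :
    ((ferrCov E (⟨0, hn⟩ : Fin n))ᶜ).card = n := by
  have h := ferr_card E ⟨0, hn⟩
  rw [Finset.filter_true_of_mem] at h
  · simp at h ⊢; omega
  · intro j _
    obtain ⟨i, hi⟩ := hy j
    exact hF i j _ j hi (by rw [Fin.le_def]; simp) le_rfl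

lemma ferr_stair (E : Finset (Fin n × Fin n))
    (hF : ∀ i j p q : Fin n, (i, j) ∈ E → p ≤ i → q ≤ j → (p, q) ∈ E)
    (h : ∀ a : Fin n, ((ferrCov E a)ᶜ).card = n) (i j : Fin n) :
    (i, j) ∈ E ↔ i.val + j.val < n := by
  have h1 := ferr_card E i
  rw [h i] at h1
  constructor
  · intro hij
    have : Finset.Iic j ⊆ Finset.univ.filter (fun j => (i, j) ∈ E) := by
      intro k hk
      simpa using hF i j i k hij le_rfl (Finset.mem_Iic.mp hk)
    have := Finset.card_le_card this
    rw [Fin.card_Iic] at this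
    omega
  · intro hij
    by_contra hne
    have : Finset.univ.filter (fun j => (i, j) ∈ E) ⊆ Finset.Iio j := by
      intro k hk
      rw [Finset.mem_Iio]
      by_contra hle
      exact hne (hF i k i j (by simpa using hk) le_rfl (not_lt.mp hle))
    have := Finset.card_le_card this
    rw [Fin.card_Iio] at this
    omega

/-- The Hilbert series of a polynomial ring. -/
noncomputable def ferrG (s : ℕ) : PowerSeries ℤ := PowerSeries.mk fun d => (s.multichoose d : ℤ)

lemma ferrG_mul (hn : 1 ≤ n) : (1 - PowerSeries.X) ^ n * ferrG n = 1 := by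
  obtain ⟨d, rfl⟩ : ∃ d, n = d + 1 := ⟨n - 1, by omega⟩
  rw [mul_comm]
  refine Eq.trans ?_ (PowerSeries.mk_add_choose_mul_one_sub_pow_eq_one ℤ d)
  congr 1
  ext k
  simp only [ferrG, PowerSeries.coeff_mk]
  rw [Nat.multichoose_eq]
  have : d + 1 + k - 1 = d + k := by omega
  rw [this, Nat.choose_symm_add]

lemma ferr_multichoose_two (s : ℕ) : 2 * s.multichoose 2 = s * (s + 1) := by
  induction s with
  | zero => simp
  | succ s ih =>
    have : (s + 1).multichoose 2 = s.multichoose 2 + (s + 1) := by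
      rw [Nat.multichoose_succ_succ, Nat.multichoose_one_right]
    rw [this]
    linarith

lemma ferr_series_eq (K : Type*) [Field K] (E : Finset (Fin n × Fin n))
    (hF : ∀ i j p q : Fin n, (i, j) ∈ E → p ≤ i → q ≤ j → (p, q) ∈ E) :
    hilbertSeries K (ferrI K E) =
      ferrG n + PowerSeries.X * ∑ a : Fin n, ferrG ((ferrCov E a)ᶜ).card := by
  ext d
  rcases d with _ | d
  · simp only [hilbertSeries, PowerSeries.coeff_mk, ferr_hilbertFn, ferrStd_zero, map_add,
      PowerSeries.coeff_zero_X_mul, ferrG]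
    simp
  · simp only [hilbertSeries, PowerSeries.coeff_mk, ferr_hilbertFn, ferrStd_succ E hF, map_add,
      PowerSeries.coeff_succ_X_mul, ferrG, map_sum]
    push_cast
    rfl

lemma ferr_series (K : Type*) [Field K] (hn : 1 ≤ n) (E : Finset (Fin n × Fin n))
    (hF : ∀ i j p q : Fin n, (i, j) ∈ E → p ≤ i → q ≤ j → (p, q) ∈ E) :
    (1 - PowerSeries.X) ^ n * hilbertSeries K (ferrI K E) =
      1 + (n : PowerSeries ℤ) * PowerSeries.X ↔
    ∀ a : Fin n, ((ferrCov E a)ᶜ).card = n := by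
  rw [ferr_series_eq K E hF]
  have hG := ferrG_mul hn
  constructor
  · intro h
    have h1 : PowerSeries.X * ((1 - PowerSeries.X) ^ n * ∑ a : Fin n, ferrG ((ferrCov E a)ᶜ).card)
        = PowerSeries.X * (n : PowerSeries ℤ) := by
      linear_combination h - hG
    have h2 := mul_left_cancel₀ PowerSeries.X_ne_zero h1
    have h3 : ∑ a : Fin n, ferrG ((ferrCov E a)ᶜ).card = (n : ℤ) • ferrG n := by
      rw [zsmul_eq_mul, Int.cast_natCast]
      linear_combination ferrG n * h2 - (∑ a : Fin n, ferrG ((ferrCov E a)ᶜ).card) * hG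
    have c1 := congrArg (PowerSeries.coeff 1) h3
    have c2 := congrArg (PowerSeries.coeff 2) h3
    simp only [map_sum, map_zsmul, ferrG, PowerSeries.coeff_mk, smul_eq_mul] at c1 c2
    simp only [Nat.multichoose_one_right] at c1
    have t : ∀ s : ℕ, 2 * (s.multichoose 2 : ℤ) = s * (s + 1) := by
      intro s; exact_mod_cast ferr_multichoose_two s
    have c2' : ∑ a : Fin n, ((((ferrCov E a)ᶜ).card : ℤ) * (((ferrCov E a)ᶜ).card + 1))
        = n * (n * (n + 1)) := by
      rw [← t n]
      simp only [← t]
      rw [← Finset.mul_sum, c2]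
      ring
    have c3 : ∑ a : Fin n, ((((ferrCov E a)ᶜ).card : ℤ) - n) ^ 2 = 0 := by
      have : ∀ a : Fin n, ((((ferrCov E a)ᶜ).card : ℤ) - n) ^ 2 =
          (((ferrCov E a)ᶜ).card : ℤ) * (((ferrCov E a)ᶜ).card + 1)
          - (2 * n + 1) * ((ferrCov E a)ᶜ).card + n ^ 2 := fun a => by ring
      simp only [this]
      rw [Finset.sum_add_distrib, Finset.sum_sub_distrib, c2', ← Finset.mul_sum, c1]
      simp
      ring
    intro a
    have h4 := (Finset.sum_eq_zero_iff_of_nonneg (fun a _ => sq_nonneg _)).mp c3 a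
      (Finset.mem_univ a)
    have h5 := pow_eq_zero_iff (two_ne_zero) |>.mp h4
    omega
  · intro h
    simp only [h, Finset.sum_const, Finset.card_univ, Fintype.card_fin, nsmul_eq_mul]
    linear_combination (1 + PowerSeries.X * (n : PowerSeries ℤ)) * hG

end Series

open scoped MvPolynomial in
/-- For a Ferrers graph `G` on vertex sets `{x₁,…,xₙ}` and `{y₁,…,yₙ}` (no
isolated vertices), `S/I(G)` is Cohen–Macaulay iff its Hilbert series is
`(1 + n t)/(1 − t)ⁿ`. -/
theorem stmt10 (K : Type*) [Field K] (n : ℕ) (hn : 1 ≤ n)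
    (E : Finset (Fin n × Fin n))
    (hFerrers : ∀ i j p q : Fin n, (i, j) ∈ E → p ≤ i → q ≤ j → (p, q) ∈ E)
    (hx : ∀ i : Fin n, ∃ j, (i, j) ∈ E) (hy : ∀ j : Fin n, ∃ i, (i, j) ∈ E)
    (I : Ideal (MvPolynomial (Fin n ⊕ Fin n) K))
    (hI : I = Ideal.span
      {p | ∃ e ∈ E, p = MvPolynomial.X (Sum.inl e.1) * MvPolynomial.X (Sum.inr e.2)}) :
    QuotIsCM K I ↔
      (1 - PowerSeries.X) ^ n * hilbertSeries K I = 1 + (n : PowerSeries ℤ) * PowerSeries.X := by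
  subst hI
  change QuotIsCM K (ferrI K E) ↔
    (1 - PowerSeries.X) ^ n * hilbertSeries K (ferrI K E) = 1 + (n : PowerSeries ℤ) * PowerSeries.X
  rw [ferr_series K hn E hFerrers]
  have h0 : ((ferrCov E (⟨0, hn⟩ : Fin n))ᶜ).card = n := ferr_card_zero hn E hFerrers hy
  constructor
  · intro h a
    unfold QuotIsCM at h
    apply le_antisymm
    · have h1 := ferr_le_dim K E hFerrers a
      have h2 := ferr_depth_le K E hFerrers hx ⟨0, hn⟩
      rw [h] at h1
      rw [h0] at h2
      have h3 : (((ferrCov E a)ᶜ).card : ℕ∞) ≤ idealDepth (irrelevantIdeal K (ferrI K E)) := by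
        exact_mod_cast h1
      exact_mod_cast h3.trans h2
    · have h1 := ferr_le_dim K E hFerrers (⟨0, hn⟩ : Fin n)
      have h2 := ferr_depth_le K E hFerrers hx a
      rw [h, h0] at h1
      have h3 : (n : ℕ∞) ≤ idealDepth (irrelevantIdeal K (ferrI K E)) := by
        exact_mod_cast h1
      exact_mod_cast h3.trans h2
  · intro h
    have hE := ferr_stair E hFerrers h
    have hd : idealDepth (irrelevantIdeal K (ferrI K E)) = n := by
      apply le_antisymm
      · have h2 := ferr_depth_le K E hFerrers hx ⟨0, hn⟩
        rwa [h0] at h2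
      · exact ferr_le_depth K E hE
    unfold QuotIsCM
    rw [hd]
    apply le_antisymm
    · refine ferr_dim_le K E n ?_
      intro k hk
      rcases hk.lt_or_eq with hk | rfl
      · exact (h ⟨k, hk⟩).le
      · exact (ferrCov_n E).le
    · have h1 := ferr_le_dim K E hFerrers n
      rwa [ferrCov_n] at h1
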